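/- Define $g_0(p_X \cdot p_{Y|X}) = \max\{I(Y;U) : X-Y-U \text{ Markov}, X \independent U\}$. For fixed conditional distribution $p_{Y|X}$, the map $p_X \mapsto g_0(p_X \cdot p_{Y|X})$ is convex on the probability simplex over $\mathcal{X}$. -/

import Mathlib

open Finset

/-- Shannon entropy (base 2) of a pmf on a finite alphabet. -/
noncomputable def ent {α : Type*} [Fintype α] (p : α → ℝ) : ℝ :=
  ∑ a, -(p a * Real.logb 2 (p a))

/-- Mutual information (base 2) of a joint pmf on a product of finite alphabets. -/
noncomputable def mi {α β : Type*} [Fintype α] [Fintype β] (q : α × β → ℝ) : ℝ :=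
  ent (fun a => ∑ b, q (a, b)) + ent (fun b => ∑ a, q (a, b)) - ent q

/-- `g₀(p_X · p_{Y|X})`: the optimal utility `I(Y;U)` over channels `p_{U|Y}`
(on the finite alphabet `γ`) achieving perfect privacy `X ⟂ U` in the Markov chain
`X - Y - U`. -/
noncomputable def g0 (γ : Type*) [Fintype γ] {α β : Type*} [Fintype α] [Fintype β]
    (pYX : α → β → ℝ) (pX : α → ℝ) : ℝ :=
  sSup { v : ℝ | ∃ q : β → γ → ℝ, (∀ y u, 0 ≤ q y u) ∧ (∀ y, ∑ u, q y u = 1) ∧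
    (∀ (x : α) (u : γ),
      (∑ y, pX x * pYX x y * q y u)
        = pX x * (∑ x', ∑ y, pX x' * pYX x' y * q y u)) ∧
    v = mi (fun w : β × γ => ∑ x, pX x * pYX x w.1 * q w.1 w.2) }

/-- Chain rule `H(Y,U) = H(Y) + H(U|Y)`. -/
lemma ent_mul_channel {β γ : Type*} [Fintype β] [Fintype γ] (P : β → ℝ) (q : β → γ → ℝ)
    (hq : ∀ y, ∑ u, q y u = 1) :
    ent (fun w : β × γ => P w.1 * q w.1 w.2) = ent P + ∑ y, P y * ent (q y) := by
  unfold ent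
  rw [Fintype.sum_prod_type, ← Finset.sum_add_distrib]
  refine Finset.sum_congr rfl fun y _ => ?_
  have key : ∀ u, -(P y * q y u * Real.logb 2 (P y * q y u)) =
      -(P y * Real.logb 2 (P y)) * q y u + P y * -(q y u * Real.logb 2 (q y u)) := by
    intro u
    by_cases hP : P y = 0
    · simp [hP]
    by_cases hqu : q y u = 0
    · simp [hqu]
    rw [Real.logb_mul hP hqu]
    ring
  simp only [key]
  rw [Finset.sum_add_distrib, ← Finset.mul_sum, ← Finset.mul_sum, hq, mul_one]

/-- `I(Y;U) = H(U) - H(U|Y)`. -/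
lemma mi_mul_channel {β γ : Type*} [Fintype β] [Fintype γ] (P : β → ℝ) (q : β → γ → ℝ)
    (hq : ∀ y, ∑ u, q y u = 1) :
    mi (fun w : β × γ => P w.1 * q w.1 w.2) =
      ent (fun u => ∑ y, P y * q y u) - ∑ y, P y * ent (q y) := by
  unfold mi
  rw [ent_mul_channel P q hq]
  simp only [← Finset.mul_sum, hq, mul_one]
  ring

lemma ent_nonneg {γ : Type*} [Fintype γ] (r : γ → ℝ) (h0 : ∀ u, 0 ≤ r u)
    (h1 : ∑ u, r u = 1) : 0 ≤ ent r := by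
  refine Finset.sum_nonneg fun u _ => ?_
  have hle : r u ≤ 1 := h1 ▸ Finset.single_le_sum (fun i _ => h0 i) (Finset.mem_univ u)
  have := Real.logb_nonpos (b := 2) (by norm_num) (h0 u) hle
  nlinarith [h0 u]

lemma ent_le_card_div_log_two {γ : Type*} [Fintype γ] (r : γ → ℝ) (h0 : ∀ u, 0 ≤ r u) :
    ent r ≤ Fintype.card γ / Real.log 2 := by
  have h : ∀ u ∈ Finset.univ, -(r u * Real.logb 2 (r u)) ≤ 1 / Real.log 2 := by
    intro u _
    have h2 : 0 < Real.log 2 := Real.log_pos (by norm_num)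
    rw [Real.logb, ← mul_div_assoc, ← neg_div]
    gcongr
    rcases (h0 u).eq_or_lt with h | h
    · simp [← h]
    · have := Real.one_sub_inv_le_log_of_pos h
      have h3 := mul_le_mul_of_nonneg_left this h.le
      rw [mul_sub, mul_inv_cancel₀ h.ne'] at h3
      linarith
  refine (Finset.sum_le_card_nsmul _ _ _ h).trans_eq ?_
  simp [div_eq_mul_inv]

/-- The values of `I(Y;U)` over all channels are bounded above. -/
lemma mi_mul_channel_le {β γ : Type*} [Fintype β] [Fintype γ] (P : β → ℝ) (q : β → γ → ℝ)
    (hP : ∀ y, 0 ≤ P y) (hq0 : ∀ y u, 0 ≤ q y u) (hq : ∀ y, ∑ u, q y u = 1) :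
    mi (fun w : β × γ => P w.1 * q w.1 w.2) ≤ Fintype.card γ / Real.log 2 := by
  rw [mi_mul_channel P q hq]
  have h1 := ent_le_card_div_log_two (fun u => ∑ y, P y * q y u)
    fun u => Finset.sum_nonneg fun y _ => mul_nonneg (hP y) (hq0 y u)
  have h2 : 0 ≤ ∑ y, P y * ent (q y) :=
    Finset.sum_nonneg fun y _ => mul_nonneg (hP y) (ent_nonneg _ (hq0 y) (hq y))
  linarith

/-- If the output law of a channel is the same from every input in the support of `p`, it is
the output law under `p`. -/
lemma sum_mul_eq_of_private {α β γ : Type*} [Fintype α] [Fintype β] (pYX : α → β → ℝ)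
    (q : β → γ → ℝ) (p p' : α → ℝ) (hp' : ∑ x, p' x = 1) (hsupp : ∀ x, p x = 0 → p' x = 0)
    (u : γ) (R : ℝ) (hpriv : ∀ x, ∑ y, p x * pYX x y * q y u = p x * R) :
    (∀ x, ∑ y, p' x * pYX x y * q y u = p' x * R) ∧
      ∑ x, ∑ y, p' x * pYX x y * q y u = R := by
  have h : ∀ x, ∑ y, p' x * pYX x y * q y u = p' x * R := by
    intro x
    by_cases hx : p x = 0
    · simp [hsupp x hx]
    have h := hpriv x
    simp only [mul_assoc, ← Finset.mul_sum] at h ⊢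
    rw [mul_left_cancel₀ hx h]
  exact ⟨h, by simp only [h, ← Finset.sum_mul, hp', one_mul]⟩

/-- For fixed `p_{Y|X}`, the map `p_X ↦ g₀(p_X · p_{Y|X})` is convex on the
probability simplex. -/
theorem stmt15 {α β : Type*} [Fintype α] [Fintype β] (γ : Type*) [Fintype γ]
    [Nonempty γ]
    (pYX : α → β → ℝ)
    (hpYX : ∀ x, (∀ y, 0 ≤ pYX x y) ∧ ∑ y, pYX x y = 1) :
    ConvexOn ℝ {p : α → ℝ | (∀ x, 0 ≤ p x) ∧ ∑ x, p x = 1} (g0 γ pYX) := by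
  have hbdd : ∀ (p : α → ℝ), (∀ x, 0 ≤ p x) → BddAbove { v : ℝ | ∃ q : β → γ → ℝ,
      (∀ y u, 0 ≤ q y u) ∧ (∀ y, ∑ u, q y u = 1) ∧
      (∀ (x : α) (u : γ), (∑ y, p x * pYX x y * q y u)
        = p x * (∑ x', ∑ y, p x' * pYX x' y * q y u)) ∧
      v = mi (fun w : β × γ => ∑ x, p x * pYX x w.1 * q w.1 w.2) } := by
    intro p hp
    refine ⟨Fintype.card γ / Real.log 2, ?_⟩
    rintro v ⟨q, hq0, hq1, -, rfl⟩
    simp only [← Finset.sum_mul]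
    exact mi_mul_channel_le (fun y => ∑ x, p x * pYX x y) q
      (fun y => Finset.sum_nonneg fun x _ => mul_nonneg (hp x) ((hpYX x).1 y)) hq0 hq1
  have hconv : Convex ℝ {p : α → ℝ | (∀ x, 0 ≤ p x) ∧ ∑ x, p x = 1} := convex_stdSimplex ℝ α
  refine convexOn_iff_forall_pos.2 ⟨hconv, ?_⟩
  intro p₁ h₁ p₂ h₂ a b ha hb hab
  obtain ⟨hp0, hp1⟩ := hconv h₁ h₂ ha.le hb.le hab
  have hsupp : ∀ x, (a • p₁ + b • p₂) x = 0 → p₁ x = 0 ∧ p₂ x = 0 := by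
    intro x hx
    simp only [Pi.add_apply, Pi.smul_apply, smul_eq_mul] at hx
    have e₁ := mul_nonneg ha.le (h₁.1 x)
    have e₂ := mul_nonneg hb.le (h₂.1 x)
    have f₁ : a * p₁ x = 0 := by linarith
    have f₂ : b * p₂ x = 0 := by linarith
    exact ⟨(mul_eq_zero.1 f₁).resolve_left ha.ne', (mul_eq_zero.1 f₂).resolve_left hb.ne'⟩
  have hsum : ∀ x, a * p₁ x + b * p₂ x = (a • p₁ + b • p₂) x := fun x => rfl
  generalize a • p₁ + b • p₂ = p at *
  refine csSup_le ?_ ?_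
  · have hc : (Fintype.card γ : ℝ) ≠ 0 := by simp
    refine ⟨_, fun _ _ => (Fintype.card γ : ℝ)⁻¹, fun _ _ => by positivity,
      fun _ => by simp [hc], fun x u => ?_, rfl⟩
    simp only [← Finset.sum_mul, ← Finset.mul_sum, (hpYX _).2, mul_one, hp1, one_mul]
  · rintro v ⟨q, hq0, hq1, hpriv, rfl⟩
    have s₁ := fun u => sum_mul_eq_of_private pYX q p p₁ h₁.2 (fun x hx => (hsupp x hx).1) u _
      (fun x => hpriv x u)
    have s₂ := fun u => sum_mul_eq_of_private pYX q p p₂ h₂.2 (fun x hx => (hsupp x hx).2) u _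
      (fun x => hpriv x u)
    have l₁ := le_csSup (hbdd p₁ h₁.1)
      ⟨q, hq0, hq1, fun x u => by rw [(s₁ u).1 x, (s₁ u).2], rfl⟩
    have l₂ := le_csSup (hbdd p₂ h₂.1)
      ⟨q, hq0, hq1, fun x u => by rw [(s₂ u).1 x, (s₂ u).2], rfl⟩
    refine le_trans (le_of_eq ?_)
      (add_le_add (mul_le_mul_of_nonneg_left l₁ ha.le) (mul_le_mul_of_nonneg_left l₂ hb.le))
    have hmi : ∀ p' : α → ℝ, mi (fun w : β × γ => ∑ x, p' x * pYX x w.1 * q w.1 w.2) =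
        ent (fun u => ∑ x, ∑ y, p' x * pYX x y * q y u)
          - ∑ y, (∑ x, p' x * pYX x y) * ent (q y) := by
      intro p'
      simp only [← Finset.sum_mul]
      rw [mi_mul_channel (fun y => ∑ x, p' x * pYX x y) q hq1]
      congr 2
      funext u
      rw [Finset.sum_comm]
      simp only [Finset.sum_mul]
    have hlin : ∑ y, (∑ x, p x * pYX x y) * ent (q y) =
        a * ∑ y, (∑ x, p₁ x * pYX x y) * ent (q y)
          + b * ∑ y, (∑ x, p₂ x * pYX x y) * ent (q y) := by
      simp only [← hsum, Finset.sum_mul, Finset.mul_sum, ← Finset.sum_add_distrib]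
      exact Finset.sum_congr rfl fun y _ => Finset.sum_congr rfl fun x _ => by ring
    rw [hmi, hmi, hmi, hlin]
    simp only [fun u => (s₁ u).2, fun u => (s₂ u).2]
    linear_combination -hab * ent (fun u => ∑ x, ∑ y, p x * pYX x y * q y u)
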